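/- If (NLP) is feasible, then (NLP) has an optimal solution (x, y, r, z, θ) together with (r^{k,s,p}) satisfying, for all (i,j) ∈ L, k ∈ K, s ∈ F^k∪{0}: r^{k,s,1} = 1; r^{k,s,p} = 0 for all p ≥ 2; r_{ij}^{k,s,p} = 0 for all p ≥ 2; and z_{ij}^{k,s,p} = r_{ij}^{k,s,1} ≤ 1 for all p ∈ P. -/

import Mathlib

open Finset

/-- Data of the network slicing (NS) problem. -/
structure NSData where
  I : Type
  fintypeI : Fintype I
  deqI : DecidableEq I
  K : Type
  fintypeK : Fintype K
  /-- the set of directed links -/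
  L : Finset (I × I)
  /-- the set of cloud nodes -/
  V : Finset I
  /-- computational capacity of cloud nodes -/
  mu : I → ℝ
  /-- reliability of cloud nodes -/
  gv : I → ℝ
  /-- communication delay of links -/
  dl : I × I → ℝ
  /-- reliability of links -/
  gl : I × I → ℝ
  /-- communication capacity of links -/
  Cl : I × I → ℝ
  /-- source node of each service -/
  src : K → I
  /-- destination node of each service -/
  dst : K → I
  /-- SFC length of each service -/
  len : K → ℕ
  /-- data rates -/
  lam : K → ℕ → ℝ
  /-- NFV delays -/
  dv : I → K → ℕ → ℝ
  /-- E2E delay thresholds -/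
  Th : K → ℝ
  /-- E2E reliability thresholds -/
  Ga : K → ℝ
  /-- number of paths -/
  P : ℕ
  /-- objective weight -/
  sigma : ℝ
  hmu : ∀ v ∈ V, 0 < mu v
  hgv : ∀ v ∈ V, gv v ∈ Set.Ioc (0:ℝ) 1
  hdl : ∀ e ∈ L, 0 ≤ dl e
  hgl : ∀ e ∈ L, gl e ∈ Set.Ioc (0:ℝ) 1
  hCl : ∀ e ∈ L, 0 < Cl e
  hsrc : ∀ k, src k ∉ V
  hdst : ∀ k, dst k ∉ V
  hlen : ∀ k, 1 ≤ len k
  hlam : ∀ k : K, ∀ s ≤ len k, 0 < lam k s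
  hdv : ∀ v ∈ V, ∀ k : K, ∀ s : ℕ, 1 ≤ s → s ≤ len k → 0 ≤ dv v k s
  hTh : ∀ k, 0 < Th k
  hGa : ∀ k, Ga k ∈ Set.Ioc (0:ℝ) 1
  hP : 1 ≤ P
  hsigma : 0 < sigma

attribute [instance] NSData.fintypeI NSData.deqI NSData.fintypeK

namespace NSData

variable (D : NSData)

/-- index set `F^k = {1,…,ℓ_k}` -/
def Fk (k : D.K) : Finset ℕ := Finset.Icc 1 (D.len k)

/-- index set `F^k ∪ {0} = {0,1,…,ℓ_k}` -/
def Fk0 (k : D.K) : Finset ℕ := Finset.Icc 0 (D.len k)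

/-- path index set `P = {1,…,P}` -/
def Pset : Finset ℕ := Finset.Icc 1 D.P

theorem Pset_nonempty : D.Pset.Nonempty := Finset.nonempty_Icc.mpr D.hP

/-- sum of `f` over links coming into node `i` -/
noncomputable def inS (i : D.I) (f : D.I × D.I → ℝ) : ℝ :=
  ∑ e ∈ D.L.filter (fun e => e.2 = i), f e

/-- sum of `f` over links going out of node `i` -/
noncomputable def outS (i : D.I) (f : D.I × D.I → ℝ) : ℝ :=
  ∑ e ∈ D.L.filter (fun e => e.1 = i), f e

/-- the right hand side `b_i^{k,s}(x)` of the flow conservation constraints -/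
noncomputable def bfun (x : D.I → D.K → ℕ → ℝ) (i : D.I) (k : D.K) (s : ℕ) : ℝ :=
  if s = 0 ∧ i = D.src k then -1
  else if s = 0 ∧ i ∈ D.V then x i k 1
  else if 1 ≤ s ∧ s + 1 ≤ D.len k ∧ i ∈ D.V then x i k (s + 1) - x i k s
  else if s = D.len k ∧ i ∈ D.V then -(x i k s)
  else if s = D.len k ∧ i = D.dst k then 1
  else 0

section Constraints

variable (xs : D.I → D.K → ℕ → ℝ) (xk : D.I → D.K → ℝ) (y : D.I → ℝ)
  (z : D.I × D.I → D.K → ℕ → ℕ → ℝ) (zk : D.I × D.I → D.K → ℝ)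
  (r : D.I × D.I → D.K → ℕ → ℕ → ℝ) (rp : D.K → ℕ → ℕ → ℝ)
  (th : D.K → ℕ → ℝ) (r2 : D.I × D.I → D.K → ℕ → ℝ)

def C1 : Prop := ∀ k : D.K, ∀ s ∈ D.Fk k, ∑ v ∈ D.V, xs v k s = 1

def C2 : Prop := ∀ v ∈ D.V, ∀ k : D.K, ∀ s ∈ D.Fk k, xs v k s ≤ xk v k

def C3 : Prop := ∀ v ∈ D.V, ∀ k : D.K, xk v k ≤ y v

def C4 : Prop := ∀ v ∈ D.V, ∑ k : D.K, ∑ s ∈ D.Fk k, D.lam k s * xs v k s ≤ D.mu v * y v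

def C5 : Prop := ∀ k : D.K, ∀ s ∈ D.Fk0 k, ∀ p ∈ D.Pset, ∀ i : D.I,
  D.inS i (fun e => z e k s p) - D.outS i (fun e => z e k s p) = D.bfun xs i k s

def C6 : Prop := ∀ k : D.K, ∀ s ∈ D.Fk0 k, ∑ p ∈ D.Pset, rp k s p = 1

def C7 : Prop := ∀ e ∈ D.L, ∀ k : D.K, ∀ s ∈ D.Fk0 k, ∀ p ∈ D.Pset,
  r e k s p = rp k s p * z e k s p

def C8 : Prop := ∀ e ∈ D.L,
  ∑ k : D.K, ∑ s ∈ D.Fk0 k, ∑ p ∈ D.Pset, D.lam k s * r e k s p ≤ D.Cl e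

def C9 : Prop := ∀ e ∈ D.L, ∀ k : D.K, ∀ s ∈ D.Fk0 k, ∀ p ∈ D.Pset, z e k s p ≤ zk e k

def C10 : Prop := ∀ k : D.K,
  ∑ v ∈ D.V, Real.log (D.gv v) * xk v k + ∑ e ∈ D.L, Real.log (D.gl e) * zk e k
    ≥ Real.log (D.Ga k)

def C11 : Prop := ∀ k : D.K, ∀ s ∈ D.Fk0 k,
  IsGreatest ((fun p => ∑ e ∈ D.L, D.dl e * z e k s p) '' (D.Pset : Set ℕ)) (th k s)

def C12 : Prop := ∀ k : D.K,
  ∑ v ∈ D.V, ∑ s ∈ D.Fk k, D.dv v k s * xs v k s + ∑ s ∈ D.Fk0 k, th k s ≤ D.Th k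

def C16 : Prop := ∀ k : D.K, ∀ s ∈ D.Fk0 k, ∀ p ∈ D.Pset,
  ∑ e ∈ D.L, D.dl e * z e k s p ≤ th k s

def C18 : Prop := ∀ e ∈ D.L, ∀ k : D.K, ∀ s ∈ D.Fk0 k, ∑ p ∈ D.Pset, r e k s p ≤ zk e k

def C19 : Prop := ∀ k : D.K, ∀ s ∈ D.Fk0 k,
  ∑ e ∈ D.L, D.dl e * ∑ p ∈ D.Pset, r e k s p ≤ th k s

def C20 : Prop := ∀ i : D.I, ∀ k : D.K, ∀ s ∈ D.Fk0 k, ∀ p ∈ D.Pset,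
  D.outS i (fun e => z e k s p) ≤ 1

def C21 : Prop := ∀ e ∈ D.L, ∀ k : D.K, ∀ s ∈ D.Fk0 k, ∀ p ∈ D.Pset, r e k s p ≤ z e k s p

def C22 : Prop := ∀ k : D.K, ∀ s ∈ D.Fk0 k, ∀ i : D.I,
  ((s = 0 ∧ (i ∈ D.V ∨ i = D.src k)) ∨ (s = D.len k ∧ (i ∈ D.V ∨ i = D.dst k)) ∨
      (1 ≤ s ∧ s + 1 ≤ D.len k ∧ i ∈ D.V)) →
    D.inS i (fun e => ∑ p ∈ D.Pset, r e k s p) - D.outS i (fun e => ∑ p ∈ D.Pset, r e k s p)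
      = D.bfun xs i k s

def C23 : Prop := ∀ k : D.K, ∀ s ∈ D.Fk0 k, ∀ p ∈ D.Pset, ∀ i : D.I,
  (i ∉ D.V → D.inS i (fun e => r e k s p) - D.outS i (fun e => r e k s p) = 0) ∧
  (i ∈ D.V → s + 1 ≤ D.len k →
    D.inS i (fun e => r e k s p) - D.outS i (fun e => r e k s p) ≤ xs i k (s + 1)) ∧
  (i ∈ D.V → 1 ≤ s →
    -(xs i k s) ≤ D.inS i (fun e => r e k s p) - D.outS i (fun e => r e k s p))

def C5II : Prop := ∀ k : D.K, ∀ s ∈ D.Fk0 k, ∀ i : D.I,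
  D.inS i (fun e => r2 e k s) - D.outS i (fun e => r2 e k s) = D.bfun xs i k s

def C8II : Prop := ∀ e ∈ D.L, ∑ k : D.K, ∑ s ∈ D.Fk0 k, D.lam k s * r2 e k s ≤ D.Cl e

def C9II : Prop := ∀ e ∈ D.L, ∀ k : D.K, ∀ s ∈ D.Fk0 k, r2 e k s ≤ zk e k

def C16II : Prop := ∀ k : D.K, ∀ s ∈ D.Fk0 k, ∑ e ∈ D.L, D.dl e * r2 e k s ≤ th k s

/-- binary requirements on the variables x, y, z -/
def BinVars : Prop :=
  (∀ v ∈ D.V, ∀ k : D.K, ∀ s ∈ D.Fk k, xs v k s = 0 ∨ xs v k s = 1) ∧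
  (∀ v ∈ D.V, ∀ k : D.K, xk v k = 0 ∨ xk v k = 1) ∧
  (∀ v ∈ D.V, y v = 0 ∨ y v = 1) ∧
  (∀ e ∈ D.L, ∀ k : D.K, ∀ s ∈ D.Fk0 k, ∀ p ∈ D.Pset, z e k s p = 0 ∨ z e k s p = 1) ∧
  (∀ e ∈ D.L, ∀ k : D.K, zk e k = 0 ∨ zk e k = 1)

/-- relaxed `[0,1]` requirements on the variables x, y, z -/
def UnitVars : Prop :=
  (∀ v ∈ D.V, ∀ k : D.K, ∀ s ∈ D.Fk k, xs v k s ∈ Set.Icc (0:ℝ) 1) ∧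
  (∀ v ∈ D.V, ∀ k : D.K, xk v k ∈ Set.Icc (0:ℝ) 1) ∧
  (∀ v ∈ D.V, y v ∈ Set.Icc (0:ℝ) 1) ∧
  (∀ e ∈ D.L, ∀ k : D.K, ∀ s ∈ D.Fk0 k, ∀ p ∈ D.Pset, z e k s p ∈ Set.Icc (0:ℝ) 1) ∧
  (∀ e ∈ D.L, ∀ k : D.K, zk e k ∈ Set.Icc (0:ℝ) 1)

def NonnegR : Prop := ∀ e ∈ D.L, ∀ k : D.K, ∀ s ∈ D.Fk0 k, ∀ p ∈ D.Pset, 0 ≤ r e k s p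

def NonnegRP : Prop := ∀ k : D.K, ∀ s ∈ D.Fk0 k, ∀ p ∈ D.Pset, 0 ≤ rp k s p

def NonnegTh : Prop := ∀ k : D.K, ∀ s ∈ D.Fk0 k, 0 ≤ th k s

def UnitR2 : Prop := ∀ e ∈ D.L, ∀ k : D.K, ∀ s ∈ D.Fk0 k, r2 e k s ∈ Set.Icc (0:ℝ) 1

/-- common objective function of (MINLP), (MILP), (NLP) and (LP-I) -/
noncomputable def Obj : ℝ :=
  ∑ v ∈ D.V, y v +
    D.sigma * ∑ e ∈ D.L, ∑ k : D.K, ∑ s ∈ D.Fk0 k, ∑ p ∈ D.Pset, D.lam k s * r e k s p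

/-- objective function of (LP-II) -/
noncomputable def ObjII : ℝ :=
  ∑ v ∈ D.V, y v + D.sigma * ∑ e ∈ D.L, ∑ k : D.K, ∑ s ∈ D.Fk0 k, D.lam k s * r2 e k s

/-- feasibility for problem (MINLP) -/
def MINLPFeas : Prop :=
  D.C1 xs ∧ D.C2 xs xk ∧ D.C3 xk y ∧ D.C4 xs y ∧ D.C5 xs z ∧ D.C6 rp ∧
    D.C7 z r rp ∧ D.C8 r ∧ D.C9 z zk ∧ D.C10 xk zk ∧ D.C11 z th ∧ D.C12 xs th ∧
    D.BinVars xs xk y z zk ∧ D.NonnegR r ∧ D.NonnegRP rp ∧ D.NonnegTh th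

/-- feasibility for problem (MINLP) with (C11) replaced by (C16) -/
def MINLP16Feas : Prop :=
  D.C1 xs ∧ D.C2 xs xk ∧ D.C3 xk y ∧ D.C4 xs y ∧ D.C5 xs z ∧ D.C6 rp ∧
    D.C7 z r rp ∧ D.C8 r ∧ D.C9 z zk ∧ D.C10 xk zk ∧ D.C16 z th ∧ D.C12 xs th ∧
    D.BinVars xs xk y z zk ∧ D.NonnegR r ∧ D.NonnegRP rp ∧ D.NonnegTh th

/-- feasibility for problem (MILP) -/
def MILPFeas : Prop :=
  D.C1 xs ∧ D.C2 xs xk ∧ D.C3 xk y ∧ D.C4 xs y ∧ D.C8 r ∧ D.C9 z zk ∧ D.C10 xk zk ∧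
    D.C12 xs th ∧ D.C16 z th ∧ D.C18 zk r ∧ D.C19 r th ∧ D.C20 z ∧ D.C21 z r ∧
    D.C22 xs r ∧ D.C23 xs r ∧ D.BinVars xs xk y z zk ∧ D.NonnegR r ∧ D.NonnegTh th

/-- feasibility for problem (NLP), the continuous relaxation of (MINLP) -/
def NLPFeas : Prop :=
  D.C1 xs ∧ D.C2 xs xk ∧ D.C3 xk y ∧ D.C4 xs y ∧ D.C5 xs z ∧ D.C6 rp ∧
    D.C7 z r rp ∧ D.C8 r ∧ D.C9 z zk ∧ D.C10 xk zk ∧ D.C12 xs th ∧ D.C16 z th ∧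
    D.UnitVars xs xk y z zk ∧ D.NonnegR r ∧ D.NonnegRP rp ∧ D.NonnegTh th

/-- feasibility for problem (LP-I), the continuous relaxation of (MILP) -/
def LPIFeas : Prop :=
  D.C1 xs ∧ D.C2 xs xk ∧ D.C3 xk y ∧ D.C4 xs y ∧ D.C8 r ∧ D.C9 z zk ∧ D.C10 xk zk ∧
    D.C12 xs th ∧ D.C16 z th ∧ D.C18 zk r ∧ D.C19 r th ∧ D.C20 z ∧ D.C21 z r ∧
    D.C22 xs r ∧ D.C23 xs r ∧ D.UnitVars xs xk y z zk ∧ D.NonnegR r ∧ D.NonnegTh th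

/-- feasibility for problem (LP-I'), which is (LP-I) with (C20) removed -/
def LPIpFeas : Prop :=
  D.C1 xs ∧ D.C2 xs xk ∧ D.C3 xk y ∧ D.C4 xs y ∧ D.C8 r ∧ D.C9 z zk ∧ D.C10 xk zk ∧
    D.C12 xs th ∧ D.C16 z th ∧ D.C18 zk r ∧ D.C19 r th ∧ D.C21 z r ∧
    D.C22 xs r ∧ D.C23 xs r ∧ D.UnitVars xs xk y z zk ∧ D.NonnegR r ∧ D.NonnegTh th

/-- feasibility for problem (LP-II) -/
def LPIIFeas : Prop :=
  D.C1 xs ∧ D.C2 xs xk ∧ D.C3 xk y ∧ D.C4 xs y ∧ D.C10 xk zk ∧ D.C12 xs th ∧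
    D.C5II xs r2 ∧ D.C8II r2 ∧ D.C9II zk r2 ∧ D.C16II th r2 ∧
    (∀ v ∈ D.V, ∀ k : D.K, ∀ s ∈ D.Fk k, xs v k s ∈ Set.Icc (0:ℝ) 1) ∧
    (∀ v ∈ D.V, ∀ k : D.K, xk v k ∈ Set.Icc (0:ℝ) 1) ∧
    (∀ v ∈ D.V, y v ∈ Set.Icc (0:ℝ) 1) ∧
    (∀ e ∈ D.L, ∀ k : D.K, zk e k ∈ Set.Icc (0:ℝ) 1) ∧
    D.UnitR2 r2 ∧ D.NonnegTh th

/-- the links `{(i,j) ∈ L : z_{ij}^{k,s,p} = 1}` form an elementary directed path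
`i_0 → i_1 → ⋯ → i_t` (`t ≥ 1`) from the source (where `b = -1`) to the destination
(where `b = 1`) of flow `(k,s)`, along which the values of `r` all equal `ρ`. -/
def FormsPath (k : D.K) (s p : ℕ) (rho : ℝ) : Prop :=
  ∃ (t : ℕ) (f : ℕ → D.I), 1 ≤ t ∧
    (∀ m ≤ t, ∀ n ≤ t, f m = f n → m = n) ∧
    (∀ m < t, (f m, f (m + 1)) ∈ D.L) ∧
    {e : D.I × D.I | e ∈ D.L ∧ z e k s p = 1} = (fun m => (f m, f (m + 1))) '' Set.Iio t ∧
    D.bfun xs (f 0) k s = -1 ∧ D.bfun xs (f t) k s = 1 ∧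
    ∀ m < t, r (f m, f (m + 1)) k s p = rho

/-- optimality for problem (MINLP) -/
def MINLPOptimal : Prop :=
  D.MINLPFeas xs xk y z zk r rp th ∧
    ∀ (xs' : D.I → D.K → ℕ → ℝ) (xk' : D.I → D.K → ℝ) (y' : D.I → ℝ)
      (z' : D.I × D.I → D.K → ℕ → ℕ → ℝ) (zk' : D.I × D.I → D.K → ℝ)
      (r' : D.I × D.I → D.K → ℕ → ℕ → ℝ) (rp' : D.K → ℕ → ℕ → ℝ) (th' : D.K → ℕ → ℝ),
      D.MINLPFeas xs' xk' y' z' zk' r' rp' th' → D.Obj y r ≤ D.Obj y' r'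

/-- optimality for problem (MILP) -/
def MILPOptimal : Prop :=
  D.MILPFeas xs xk y z zk r th ∧
    ∀ (xs' : D.I → D.K → ℕ → ℝ) (xk' : D.I → D.K → ℝ) (y' : D.I → ℝ)
      (z' : D.I × D.I → D.K → ℕ → ℕ → ℝ) (zk' : D.I × D.I → D.K → ℝ)
      (r' : D.I × D.I → D.K → ℕ → ℕ → ℝ) (th' : D.K → ℕ → ℝ),
      D.MILPFeas xs' xk' y' z' zk' r' th' → D.Obj y r ≤ D.Obj y' r'

/-- optimality for problem (NLP) -/
def NLPOptimal : Prop :=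
  D.NLPFeas xs xk y z zk r rp th ∧
    ∀ (xs' : D.I → D.K → ℕ → ℝ) (xk' : D.I → D.K → ℝ) (y' : D.I → ℝ)
      (z' : D.I × D.I → D.K → ℕ → ℕ → ℝ) (zk' : D.I × D.I → D.K → ℝ)
      (r' : D.I × D.I → D.K → ℕ → ℕ → ℝ) (rp' : D.K → ℕ → ℕ → ℝ) (th' : D.K → ℕ → ℝ),
      D.NLPFeas xs' xk' y' z' zk' r' rp' th' → D.Obj y r ≤ D.Obj y' r'

/-- optimality for problem (LP-I') -/
def LPIpOptimal : Prop :=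
  D.LPIpFeas xs xk y z zk r th ∧
    ∀ (xs' : D.I → D.K → ℕ → ℝ) (xk' : D.I → D.K → ℝ) (y' : D.I → ℝ)
      (z' : D.I × D.I → D.K → ℕ → ℕ → ℝ) (zk' : D.I × D.I → D.K → ℝ)
      (r' : D.I × D.I → D.K → ℕ → ℕ → ℝ) (th' : D.K → ℕ → ℝ),
      D.LPIpFeas xs' xk' y' z' zk' r' th' → D.Obj y r ≤ D.Obj y' r'

end Constraints

/-- the set of objective values of feasible points of (MINLP) -/
def MINLPVals : Set ℝ :=
  {c | ∃ (xs : D.I → D.K → ℕ → ℝ) (xk : D.I → D.K → ℝ) (y : D.I → ℝ)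
    (z : D.I × D.I → D.K → ℕ → ℕ → ℝ) (zk : D.I × D.I → D.K → ℝ)
    (r : D.I × D.I → D.K → ℕ → ℕ → ℝ) (rp : D.K → ℕ → ℕ → ℝ) (th : D.K → ℕ → ℝ),
    D.MINLPFeas xs xk y z zk r rp th ∧ c = D.Obj y r}

/-- the set of objective values of feasible points of (MINLP) with (C11) replaced by (C16) -/
def MINLP16Vals : Set ℝ :=
  {c | ∃ (xs : D.I → D.K → ℕ → ℝ) (xk : D.I → D.K → ℝ) (y : D.I → ℝ)
    (z : D.I × D.I → D.K → ℕ → ℕ → ℝ) (zk : D.I × D.I → D.K → ℝ)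
    (r : D.I × D.I → D.K → ℕ → ℕ → ℝ) (rp : D.K → ℕ → ℕ → ℝ) (th : D.K → ℕ → ℝ),
    D.MINLP16Feas xs xk y z zk r rp th ∧ c = D.Obj y r}

/-- the set of objective values of feasible points of (NLP) -/
def NLPVals : Set ℝ :=
  {c | ∃ (xs : D.I → D.K → ℕ → ℝ) (xk : D.I → D.K → ℝ) (y : D.I → ℝ)
    (z : D.I × D.I → D.K → ℕ → ℕ → ℝ) (zk : D.I × D.I → D.K → ℝ)
    (r : D.I × D.I → D.K → ℕ → ℕ → ℝ) (rp : D.K → ℕ → ℕ → ℝ) (th : D.K → ℕ → ℝ),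
    D.NLPFeas xs xk y z zk r rp th ∧ c = D.Obj y r}

/-- the set of objective values of feasible points of (LP-I) -/
def LPIVals : Set ℝ :=
  {c | ∃ (xs : D.I → D.K → ℕ → ℝ) (xk : D.I → D.K → ℝ) (y : D.I → ℝ)
    (z : D.I × D.I → D.K → ℕ → ℕ → ℝ) (zk : D.I × D.I → D.K → ℝ)
    (r : D.I × D.I → D.K → ℕ → ℕ → ℝ) (th : D.K → ℕ → ℝ),
    D.LPIFeas xs xk y z zk r th ∧ c = D.Obj y r}

/-- the set of objective values of feasible points of (LP-I') -/
def LPIpVals : Set ℝ :=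
  {c | ∃ (xs : D.I → D.K → ℕ → ℝ) (xk : D.I → D.K → ℝ) (y : D.I → ℝ)
    (z : D.I × D.I → D.K → ℕ → ℕ → ℝ) (zk : D.I × D.I → D.K → ℝ)
    (r : D.I × D.I → D.K → ℕ → ℕ → ℝ) (th : D.K → ℕ → ℝ),
    D.LPIpFeas xs xk y z zk r th ∧ c = D.Obj y r}

/-- the set of objective values of feasible points of (LP-I) additionally satisfying `z = r` -/
def LPIValsEq : Set ℝ :=
  {c | ∃ (xs : D.I → D.K → ℕ → ℝ) (xk : D.I → D.K → ℝ) (y : D.I → ℝ)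
    (z : D.I × D.I → D.K → ℕ → ℕ → ℝ) (zk : D.I × D.I → D.K → ℝ)
    (r : D.I × D.I → D.K → ℕ → ℕ → ℝ) (th : D.K → ℕ → ℝ),
    D.LPIFeas xs xk y z zk r th ∧
      (∀ e ∈ D.L, ∀ k : D.K, ∀ s ∈ D.Fk0 k, ∀ p ∈ D.Pset, z e k s p = r e k s p) ∧
      c = D.Obj y r}

/-- the set of objective values of feasible points of (LP-I') additionally satisfying `z = r` -/
def LPIpValsEq : Set ℝ :=
  {c | ∃ (xs : D.I → D.K → ℕ → ℝ) (xk : D.I → D.K → ℝ) (y : D.I → ℝ)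
    (z : D.I × D.I → D.K → ℕ → ℕ → ℝ) (zk : D.I × D.I → D.K → ℝ)
    (r : D.I × D.I → D.K → ℕ → ℕ → ℝ) (th : D.K → ℕ → ℝ),
    D.LPIpFeas xs xk y z zk r th ∧
      (∀ e ∈ D.L, ∀ k : D.K, ∀ s ∈ D.Fk0 k, ∀ p ∈ D.Pset, z e k s p = r e k s p) ∧
      c = D.Obj y r}

/-- the set of objective values of feasible points of (LP-II) -/
def LPIIVals : Set ℝ :=
  {c | ∃ (xs : D.I → D.K → ℕ → ℝ) (xk : D.I → D.K → ℝ) (y : D.I → ℝ)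
    (zk : D.I × D.I → D.K → ℝ) (th : D.K → ℕ → ℝ) (r2 : D.I × D.I → D.K → ℕ → ℝ),
    D.LPIIFeas xs xk y zk th r2 ∧ c = D.ObjII y r2}

end NSData

namespace NSData

variable (D : NSData)

/-- The points of (LP-II), in the argument order of `LPIIFeas`. -/
abbrev LPIIPoint : Type :=
  (D.I → D.K → ℕ → ℝ) × (D.I → D.K → ℝ) × (D.I → ℝ) × (D.I × D.I → D.K → ℝ) ×
    (D.K → ℕ → ℝ) × (D.I × D.I → D.K → ℕ → ℝ)

/-- The set of feasible points of (LP-II). -/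
def LPIIFeasSet : Set D.LPIIPoint :=
  {w | D.LPIIFeas w.1 w.2.1 w.2.2.1 w.2.2.2.1 w.2.2.2.2.1 w.2.2.2.2.2}

/-- A box containing every feasible point of (LP-II), up to the values of the variables at
irrelevant indices. -/
def LPIIBox : Set D.LPIIPoint :=
  Set.Icc 0 (fun _ _ _ => 1, fun _ _ => 1, fun _ => 1, fun _ _ => 1, fun k _ => D.Th k,
    fun _ _ _ => 1)

variable {D}

theorem mem_Fk {k : D.K} {s : ℕ} : s ∈ D.Fk k ↔ 1 ≤ s ∧ s ≤ D.len k := Finset.mem_Icc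

theorem one_mem_Pset : 1 ∈ D.Pset := Finset.mem_Icc.2 ⟨le_rfl, D.hP⟩

theorem continuous_bfun (i : D.I) (k : D.K) (s : ℕ) :
    Continuous fun x : D.I → D.K → ℕ → ℝ => D.bfun x i k s := by
  unfold bfun
  split_ifs <;> fun_prop

/-- The right hand side of flow conservation only depends on the placement variables of `k`
at cloud nodes and functions of the chain of `k`. -/
theorem bfun_congr {xs xs' : D.I → D.K → ℕ → ℝ}
    (h : ∀ v ∈ D.V, ∀ k : D.K, ∀ s ∈ D.Fk k, xs' v k s = xs v k s) (i : D.I) (k : D.K) (s : ℕ) :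
    D.bfun xs' i k s = D.bfun xs i k s := by
  have hk := D.hlen k
  unfold bfun
  split_ifs with h1 h2 h3 h4 h5
  · rfl
  · exact h i h2.2 k 1 (mem_Fk.2 ⟨le_rfl, hk⟩)
  · rw [h i h3.2.2 k (s + 1) (mem_Fk.2 ⟨by omega, h3.2.1⟩),
      h i h3.2.2 k s (mem_Fk.2 ⟨h3.1, by omega⟩)]
  · rw [h i h4.2 k s (mem_Fk.2 ⟨by omega, by omega⟩)]
  · rfl
  · rfl

theorem inS_congr {i : D.I} {f g : D.I × D.I → ℝ} (h : ∀ e ∈ D.L, f e = g e) :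
    D.inS i f = D.inS i g :=
  Finset.sum_congr rfl fun e he => h e (Finset.mem_filter.1 he).1

theorem outS_congr {i : D.I} {f g : D.I × D.I → ℝ} (h : ∀ e ∈ D.L, f e = g e) :
    D.outS i f = D.outS i g :=
  Finset.sum_congr rfl fun e he => h e (Finset.mem_filter.1 he).1

theorem inS_sum_mul (i : D.I) (c : ℕ → ℝ) (f : D.I × D.I → ℕ → ℝ) :
    D.inS i (fun e => ∑ p ∈ D.Pset, c p * f e p) =
      ∑ p ∈ D.Pset, c p * D.inS i (fun e => f e p) := by
  simp only [inS, Finset.mul_sum]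
  exact Finset.sum_comm

theorem outS_sum_mul (i : D.I) (c : ℕ → ℝ) (f : D.I × D.I → ℕ → ℝ) :
    D.outS i (fun e => ∑ p ∈ D.Pset, c p * f e p) =
      ∑ p ∈ D.Pset, c p * D.outS i (fun e => f e p) := by
  simp only [outS, Finset.mul_sum]
  exact Finset.sum_comm

theorem isClosed_LPIIFeasSet : IsClosed D.LPIIFeasSet := by
  have hb : ∀ i k s, Continuous fun w : D.LPIIPoint => D.bfun w.1 i k s :=
    fun i k s => (continuous_bfun i k s).comp continuous_fst
  simp only [LPIIFeasSet, LPIIFeas, C1, C2, C3, C4, C10, C12, C5II, C8II, C9II, C16II, UnitR2,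
    NonnegTh, inS, outS, ge_iff_le, Set.mem_Icc, Set.ofPred_and, Set.ofPred_forall]
  repeat' first
    | apply IsClosed.inter
    | (apply isClosed_iInter; intro)
    | (apply isClosed_eq <;> fun_prop)
    | (apply isClosed_le <;> fun_prop)

theorem isCompact_LPIIFeasSet_inter_box : IsCompact (D.LPIIFeasSet ∩ D.LPIIBox) :=
  isCompact_Icc.inter_left isClosed_LPIIFeasSet

theorem continuous_ObjII : Continuous fun w : D.LPIIPoint => D.ObjII w.2.2.1 w.2.2.2.2.2 := by
  unfold ObjII
  fun_prop

theorem LPIIFeas.th_le {xs : D.I → D.K → ℕ → ℝ} {xk : D.I → D.K → ℝ} {y : D.I → ℝ}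
    {zk : D.I × D.I → D.K → ℝ} {th : D.K → ℕ → ℝ} {r2 : D.I × D.I → D.K → ℕ → ℝ}
    (h : D.LPIIFeas xs xk y zk th r2) (k : D.K) {s : ℕ} (hs : s ∈ D.Fk0 k) :
    th k s ≤ D.Th k := by
  obtain ⟨-, -, -, -, -, h12, -, -, -, -, hx, -, -, -, -, hth⟩ := h
  have hdelay : 0 ≤ ∑ v ∈ D.V, ∑ s ∈ D.Fk k, D.dv v k s * xs v k s :=
    Finset.sum_nonneg fun v hv => Finset.sum_nonneg fun t ht =>
      mul_nonneg (D.hdv v hv k t (mem_Fk.1 ht).1 (mem_Fk.1 ht).2) (hx v hv k t ht).1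
  have := Finset.single_le_sum (f := th k) (fun t ht => hth k t ht) hs
  linarith [h12 k]

/-- Feasibility for (LP-II) only depends on the variables at relevant indices. -/
theorem LPIIFeas.congr {xs xs' : D.I → D.K → ℕ → ℝ} {xk xk' : D.I → D.K → ℝ} {y y' : D.I → ℝ}
    {zk zk' : D.I × D.I → D.K → ℝ} {th th' : D.K → ℕ → ℝ} {r2 r2' : D.I × D.I → D.K → ℕ → ℝ}
    (h : D.LPIIFeas xs xk y zk th r2)
    (hxs : ∀ v ∈ D.V, ∀ k : D.K, ∀ s ∈ D.Fk k, xs' v k s = xs v k s)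
    (hxk : ∀ v ∈ D.V, ∀ k : D.K, xk' v k = xk v k)
    (hy : ∀ v ∈ D.V, y' v = y v)
    (hzk : ∀ e ∈ D.L, ∀ k : D.K, zk' e k = zk e k)
    (hth : ∀ k : D.K, ∀ s ∈ D.Fk0 k, th' k s = th k s)
    (hr : ∀ e ∈ D.L, ∀ k : D.K, ∀ s ∈ D.Fk0 k, r2' e k s = r2 e k s) :
    D.LPIIFeas xs' xk' y' zk' th' r2' := by
  obtain ⟨h1, h2, h3, h4, h10, h12, h5, h8, h9, h16, ux, uxk, uy, uz, ur, uth⟩ := h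
  refine ⟨fun k s hs => ?_, fun v hv k s hs => ?_, fun v hv k => ?_, fun v hv => ?_,
    fun k => ?_, fun k => ?_, fun k s hs i => ?_, fun e he => ?_, fun e he k s hs => ?_,
    fun k s hs => ?_, fun v hv k s hs => ?_, fun v hv k => ?_, fun v hv => ?_,
    fun e he k => ?_, fun e he k s hs => ?_, fun k s hs => ?_⟩
  · rw [← h1 k s hs]
    exact Finset.sum_congr rfl fun v hv => hxs v hv k s hs
  · rw [hxs v hv k s hs, hxk v hv k]
    exact h2 v hv k s hs
  · rw [hxk v hv k, hy v hv]
    exact h3 v hv k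
  · rw [hy v hv]
    refine le_of_eq_of_le ?_ (h4 v hv)
    exact Finset.sum_congr rfl fun k _ => Finset.sum_congr rfl fun s hs => by
      rw [hxs v hv k s hs]
  · rw [Finset.sum_congr rfl fun v hv => by rw [hxk v hv k],
      Finset.sum_congr (s₁ := D.L) rfl fun e he => by rw [hzk e he k]]
    exact h10 k
  · rw [Finset.sum_congr (s₁ := D.Fk0 k) rfl fun s hs => hth k s hs,
      Finset.sum_congr rfl fun v hv => Finset.sum_congr rfl fun s hs => by rw [hxs v hv k s hs]]
    exact h12 k
  · rw [inS_congr fun e he => hr e he k s hs, outS_congr fun e he => hr e he k s hs,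
      bfun_congr hxs]
    exact h5 k s hs i
  · refine le_of_eq_of_le ?_ (h8 e he)
    exact Finset.sum_congr rfl fun k _ => Finset.sum_congr rfl fun s hs => by
      rw [hr e he k s hs]
  · rw [hr e he k s hs, hzk e he k]
    exact h9 e he k s hs
  · rw [hth k s hs]
    refine le_of_eq_of_le ?_ (h16 k s hs)
    exact Finset.sum_congr rfl fun e he => by rw [hr e he k s hs]
  · rw [hxs v hv k s hs]
    exact ux v hv k s hs
  · rw [hxk v hv k]
    exact uxk v hv k
  · rw [hy v hv]
    exact uy v hv
  · rw [hzk e he k]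
    exact uz e he k
  · rw [hr e he k s hs]
    exact ur e he k s hs
  · rw [hth k s hs]
    exact uth k s hs

theorem ObjII_congr {y y' : D.I → ℝ} {r2 r2' : D.I × D.I → D.K → ℕ → ℝ}
    (hy : ∀ v ∈ D.V, y' v = y v)
    (hr : ∀ e ∈ D.L, ∀ k : D.K, ∀ s ∈ D.Fk0 k, r2' e k s = r2 e k s) :
    D.ObjII y' r2' = D.ObjII y r2 := by
  unfold ObjII
  rw [Finset.sum_congr rfl hy]
  congr 2
  exact Finset.sum_congr rfl fun e he => Finset.sum_congr rfl fun k _ =>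
    Finset.sum_congr rfl fun s hs => by rw [hr e he k s hs]

/-- Truncating a feasible point of (LP-II) to the box changes it only at irrelevant indices. -/
theorem LPIIFeas.exists_mem_box {xs : D.I → D.K → ℕ → ℝ} {xk : D.I → D.K → ℝ} {y : D.I → ℝ}
    {zk : D.I × D.I → D.K → ℝ} {th : D.K → ℕ → ℝ} {r2 : D.I × D.I → D.K → ℕ → ℝ}
    (h : D.LPIIFeas xs xk y zk th r2) :
    ∃ w ∈ D.LPIIFeasSet ∩ D.LPIIBox, D.ObjII w.2.2.1 w.2.2.2.2.2 = D.ObjII y r2 := by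
  have hthle := h.th_le
  have hfeas := h
  obtain ⟨-, -, -, -, -, -, -, -, -, -, ux, uxk, uy, uz, ur, uth⟩ := h
  have clamp_eq {M t : ℝ} (ht : t ∈ Set.Icc 0 M) : max 0 (min M t) = t := by
    rw [min_eq_right ht.2, max_eq_right ht.1]
  have clamp_le {M t : ℝ} (hM : 0 ≤ M) : max 0 (min M t) ≤ M := max_le hM (min_le_left _ _)
  refine ⟨(fun v k s => max 0 (min 1 (xs v k s)), fun v k => max 0 (min 1 (xk v k)),
    fun v => max 0 (min 1 (y v)), fun e k => max 0 (min 1 (zk e k)),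
    fun k s => max 0 (min (D.Th k) (th k s)), fun e k s => max 0 (min 1 (r2 e k s))),
    ⟨hfeas.congr (fun v hv k s hs => clamp_eq (ux v hv k s hs))
      (fun v hv k => clamp_eq (uxk v hv k)) (fun v hv => clamp_eq (uy v hv))
      (fun e he k => clamp_eq (uz e he k))
      (fun k s hs => clamp_eq ⟨uth k s hs, hthle k hs⟩)
      (fun e he k s hs => clamp_eq (ur e he k s hs)),
      ⟨⟨fun _ _ _ => le_max_left _ _, fun _ _ => le_max_left _ _, fun _ => le_max_left _ _,
        fun _ _ => le_max_left _ _, fun _ _ => le_max_left _ _, fun _ _ _ => le_max_left _ _⟩,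
      ⟨fun _ _ _ => clamp_le zero_le_one, fun _ _ => clamp_le zero_le_one,
        fun _ => clamp_le zero_le_one, fun _ _ => clamp_le zero_le_one,
        fun k _ => clamp_le (D.hTh k).le, fun _ _ _ => clamp_le zero_le_one⟩⟩⟩, ?_⟩
  exact ObjII_congr (fun v hv => clamp_eq (uy v hv))
    (fun e he k s hs => clamp_eq (ur e he k s hs))

/-- If (LP-II) is feasible, then it has an optimal solution. -/
theorem exists_LPII_optimal
    (hfeas : ∃ xs xk y zk th r2, D.LPIIFeas xs xk y zk th r2) :
    ∃ xs xk y zk th r2, D.LPIIFeas xs xk y zk th r2 ∧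
      ∀ xs' xk' y' zk' th' r2', D.LPIIFeas xs' xk' y' zk' th' r2' →
        D.ObjII y r2 ≤ D.ObjII y' r2' := by
  obtain ⟨xs, xk, y, zk, th, r2, h⟩ := hfeas
  obtain ⟨w₀, hw₀, -⟩ := h.exists_mem_box
  obtain ⟨w, hw, hmin⟩ := isCompact_LPIIFeasSet_inter_box.exists_isMinOn ⟨w₀, hw₀⟩
    continuous_ObjII.continuousOn
  refine ⟨_, _, _, _, _, _, hw.1, fun xs' xk' y' zk' th' r2' h' => ?_⟩
  obtain ⟨w', hw', heq⟩ := h'.exists_mem_box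
  exact heq ▸ hmin hw'

theorem Obj_eq_ObjII (y : D.I → ℝ) (r : D.I × D.I → D.K → ℕ → ℕ → ℝ) :
    D.Obj y r = D.ObjII y fun e k s => ∑ p ∈ D.Pset, r e k s p := by
  simp only [Obj, ObjII, Finset.mul_sum]

theorem sum_ite_eq_one (a : ℝ) : ∑ p ∈ D.Pset, (if p = 1 then a else 0) = a := by
  rw [Finset.sum_ite_eq' D.Pset 1 fun _ => a, if_pos one_mem_Pset]

/-- Averaging the paths of a feasible point of (NLP) with the weights `rp` gives a feasible point
of (LP-II). -/
theorem NLPFeas.toLPII {xs : D.I → D.K → ℕ → ℝ} {xk : D.I → D.K → ℝ} {y : D.I → ℝ}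
    {z : D.I × D.I → D.K → ℕ → ℕ → ℝ} {zk : D.I × D.I → D.K → ℝ}
    {r : D.I × D.I → D.K → ℕ → ℕ → ℝ} {rp : D.K → ℕ → ℕ → ℝ} {th : D.K → ℕ → ℝ}
    (h : D.NLPFeas xs xk y z zk r rp th) :
    D.LPIIFeas xs xk y zk th fun e k s => ∑ p ∈ D.Pset, r e k s p := by
  obtain ⟨h1, h2, h3, h4, h5, h6, h7, h8, h9, h10, h12, h16, ⟨ux, uxk, uy, uz, uzk⟩, nr, nrp,
    nth⟩ := h
  have hr : ∀ e ∈ D.L, ∀ k, ∀ s ∈ D.Fk0 k,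
      ∑ p ∈ D.Pset, r e k s p = ∑ p ∈ D.Pset, rp k s p * z e k s p := fun e he k s hs =>
    Finset.sum_congr rfl fun p hp => h7 e he k s hs p hp
  have avg_le {k : D.K} {s : ℕ} (hs : s ∈ D.Fk0 k) {f : ℕ → ℝ} {c : ℝ}
      (hf : ∀ p ∈ D.Pset, f p ≤ c) : ∑ p ∈ D.Pset, rp k s p * f p ≤ c := by
    calc ∑ p ∈ D.Pset, rp k s p * f p ≤ ∑ p ∈ D.Pset, rp k s p * c :=
          Finset.sum_le_sum fun p hp => mul_le_mul_of_nonneg_left (hf p hp) (nrp k s hs p hp)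
      _ = c := by rw [← Finset.sum_mul, h6 k s hs, one_mul]
  have hle : ∀ e ∈ D.L, ∀ k, ∀ s ∈ D.Fk0 k, ∑ p ∈ D.Pset, r e k s p ≤ zk e k :=
    fun e he k s hs => by
      rw [hr e he k s hs]
      exact avg_le hs fun p hp => h9 e he k s hs p hp
  refine ⟨h1, h2, h3, h4, h10, h12, fun k s hs i => ?_, fun e he => ?_, hle,
    fun k s hs => ?_, ux, uxk, uy, uzk, fun e he k s hs => ⟨?_, ?_⟩, nth⟩
  · rw [inS_congr fun e he => hr e he k s hs, outS_congr fun e he => hr e he k s hs,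
      inS_sum_mul, outS_sum_mul, ← Finset.sum_sub_distrib]
    rw [Finset.sum_congr rfl fun p hp => by rw [← mul_sub, h5 k s hs p hp i], ← Finset.sum_mul,
      h6 k s hs, one_mul]
  · simpa only [Finset.mul_sum] using h8 e he
  · refine le_of_eq_of_le ?_ (avg_le hs fun p hp => h16 k s hs p hp)
    dsimp only
    rw [Finset.sum_congr rfl fun e he => by rw [hr e he k s hs]]
    simp only [Finset.mul_sum]
    rw [Finset.sum_comm]
    exact Finset.sum_congr rfl fun p _ => Finset.sum_congr rfl fun e _ => by ring
  · exact Finset.sum_nonneg fun p hp => nr e he k s hs p hp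
  · exact (hle e he k s hs).trans (uzk e he k).2

/-- A feasible point of (LP-II) gives a feasible point of (NLP) that uses the first path only. -/
theorem LPIIFeas.toNLP {xs : D.I → D.K → ℕ → ℝ} {xk : D.I → D.K → ℝ} {y : D.I → ℝ}
    {zk : D.I × D.I → D.K → ℝ} {th : D.K → ℕ → ℝ} {r2 : D.I × D.I → D.K → ℕ → ℝ}
    (h : D.LPIIFeas xs xk y zk th r2) :
    D.NLPFeas xs xk y (fun e k s _ => r2 e k s) zk
      (fun e k s p => if p = 1 then r2 e k s else 0) (fun _ _ p => if p = 1 then 1 else 0) th := by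
  obtain ⟨h1, h2, h3, h4, h10, h12, h5, h8, h9, h16, ux, uxk, uy, uzk, ur, nth⟩ := h
  refine ⟨h1, h2, h3, h4, fun k s hs p _ i => h5 k s hs i, fun k s _ => sum_ite_eq_one 1,
    fun e _ k s _ p _ => ?_, fun e he => ?_, fun e he k s hs p _ => h9 e he k s hs, h10, h12,
    fun k s hs p _ => h16 k s hs, ⟨ux, uxk, uy, fun e he k s hs p _ => ur e he k s hs, uzk⟩,
    fun e he k s hs p _ => ?_, fun k s _ p _ => ?_, nth⟩
  · simp
  · simpa only [← Finset.mul_sum, sum_ite_eq_one] using h8 e he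
  · dsimp only
    split_ifs
    exacts [(ur e he k s hs).1, le_rfl]
  · dsimp only
    split_ifs
    exacts [zero_le_one, le_rfl]

end NSData

/-- If (NLP) is feasible, then it has an optimal solution in which all the flow
is carried by the first path: `r^{k,s,1} = 1`, `r^{k,s,p} = 0` and `r_{ij}^{k,s,p} = 0` for
`p ≥ 2`, and `z_{ij}^{k,s,p} = r_{ij}^{k,s,1} ≤ 1` for all `p`. -/
theorem statement7 (D : NSData)
    (hfeas : ∃ xs xk y z zk r rp th, D.NLPFeas xs xk y z zk r rp th) :
    ∃ (xs : D.I → D.K → ℕ → ℝ) (xk : D.I → D.K → ℝ) (y : D.I → ℝ)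
      (z : D.I × D.I → D.K → ℕ → ℕ → ℝ) (zk : D.I × D.I → D.K → ℝ)
      (r : D.I × D.I → D.K → ℕ → ℕ → ℝ) (rp : D.K → ℕ → ℕ → ℝ) (th : D.K → ℕ → ℝ),
      D.NLPOptimal xs xk y z zk r rp th ∧
        ∀ e ∈ D.L, ∀ k : D.K, ∀ s ∈ D.Fk0 k,
          rp k s 1 = 1 ∧
          (∀ p ∈ D.Pset, 2 ≤ p → rp k s p = 0) ∧
          (∀ p ∈ D.Pset, 2 ≤ p → r e k s p = 0) ∧
          (∀ p ∈ D.Pset, z e k s p = r e k s 1) ∧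
          r e k s 1 ≤ 1 := by
  obtain ⟨xs₀, xk₀, y₀, z₀, zk₀, r₀, rp₀, th₀, h₀⟩ := hfeas
  obtain ⟨xs, xk, y, zk, th, r2, h, hopt⟩ :=
    NSData.exists_LPII_optimal ⟨_, _, _, _, _, _, h₀.toLPII⟩
  refine ⟨_, _, _, _, _, _, _, _, ⟨h.toNLP, fun xs' xk' y' z' zk' r' rp' th' h' => ?_⟩,
    fun e he k s hs => ⟨if_pos rfl, fun p _ hp => if_neg (by omega),
      fun p _ hp => if_neg (by omega), fun p _ => (if_pos rfl).symm, ?_⟩⟩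
  · rw [NSData.Obj_eq_ObjII, NSData.Obj_eq_ObjII]
    simp only [NSData.sum_ite_eq_one]
    exact hopt _ _ _ _ _ _ h'.toLPII
  · obtain ⟨-, -, -, -, -, -, -, -, -, -, -, -, -, -, ur, -⟩ := h
    simpa using (ur e he k s hs).2
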